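/- Let ω be a smooth closed 2-form on an open set U ⊆ ℝ^{2n} with ω^n ≥ 0 pointwise, and let p ∈ U be a point where ω_p = 0 on a 4-dimensional subspace K = ker(ω_p). Then for every v ∈ K, the bivector (∇_p ω)(v) ∈ Λ²K* satisfies ω_p^{n-2} ∧ ((∇_p ω)(v))² ≥ 0; i.e., the image of the restricted gradient D_K: K → Λ²K* is semi-definite with respect to the wedge-square form. -/

import Mathlib

open Matrix

noncomputable section

/-- The coefficient of the `2n`-form `ω^n` of a 2-form with antisymmetric coefficient
matrix `A` on `ℝ^{2n}`, relative to the standard volume form (a positive multiple of the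
usual normalization). -/
def wedgePow (n : ℕ) (A : Matrix (Fin (2 * n)) (Fin (2 * n)) ℝ) : ℝ :=
  ∑ σ : Equiv.Perm (Fin (2 * n)),
    ((Equiv.Perm.sign σ : ℤ) : ℝ) *
      ∏ i : Fin n, A (σ ⟨2 * i.1, by omega⟩) (σ ⟨2 * i.1 + 1, by omega⟩)

/-- The coefficient of the `2n`-form `A^{n-2} ∧ B ∧ B` (for 2-forms `A`, `B` on `ℝ^{2n}`,
`n ≥ 2`) relative to the standard volume form (a positive multiple of the usual
normalization). -/
def mixedPow (n : ℕ) (hn : 2 ≤ n)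
    (A B : Matrix (Fin (2 * n)) (Fin (2 * n)) ℝ) : ℝ :=
  ∑ σ : Equiv.Perm (Fin (2 * n)),
    ((Equiv.Perm.sign σ : ℤ) : ℝ) *
      (∏ i : Fin (n - 2),
        A (σ ⟨2 * i.1, by omega⟩) (σ ⟨2 * i.1 + 1, by omega⟩)) *
      B (σ ⟨2 * n - 4, by omega⟩) (σ ⟨2 * n - 3, by omega⟩) *
      B (σ ⟨2 * n - 2, by omega⟩) (σ ⟨2 * n - 1, by omega⟩)

open Filter Topology

/-- First index of the `i`-th pair. -/
def pairFst {n : ℕ} (i : Fin n) : Fin (2 * n) := ⟨2 * i.1, by omega⟩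

/-- Second index of the `i`-th pair. -/
def pairSnd {n : ℕ} (i : Fin n) : Fin (2 * n) := ⟨2 * i.1 + 1, by omega⟩

/-- The polarized wedge product of `n` two-forms. -/
def polWedge (n : ℕ) (M : Fin n → Matrix (Fin (2 * n)) (Fin (2 * n)) ℝ) : ℝ :=
  ∑ σ : Equiv.Perm (Fin (2 * n)),
    ((Equiv.Perm.sign σ : ℤ) : ℝ) *
      ∏ i : Fin n, M i (σ (pairFst i)) (σ (pairSnd i))

/-- Equivalence of pairs with indices. -/
def pairEquiv (n : ℕ) : Fin n × Fin 2 ≃ Fin (2 * n) :=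
  finProdFinEquiv.trans (finCongr (Nat.mul_comm n 2))

lemma pairEquiv_zero {n : ℕ} (i : Fin n) : pairEquiv n (i, 0) = pairFst i := by
  ext; simp [pairEquiv, pairFst]

lemma pairEquiv_one {n : ℕ} (i : Fin n) : pairEquiv n (i, 1) = pairSnd i := by
  ext; simp [pairEquiv, pairSnd]; omega

/-- The permutation of the indices induced by a permutation of the pairs. -/
def pairPerm {n : ℕ} (τ : Equiv.Perm (Fin n)) : Equiv.Perm (Fin (2 * n)) :=
  (pairEquiv n).permCongr (Equiv.prodCongrLeft fun _ : Fin 2 => τ)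

lemma pairPerm_fst {n : ℕ} (τ : Equiv.Perm (Fin n)) (i : Fin n) :
    pairPerm τ (pairFst i) = pairFst (τ i) := by
  rw [← pairEquiv_zero, ← pairEquiv_zero]
  simp [pairPerm]

lemma pairPerm_snd {n : ℕ} (τ : Equiv.Perm (Fin n)) (i : Fin n) :
    pairPerm τ (pairSnd i) = pairSnd (τ i) := by
  rw [← pairEquiv_one, ← pairEquiv_one]
  simp [pairPerm]

lemma sign_pairPerm {n : ℕ} (τ : Equiv.Perm (Fin n)) :
    Equiv.Perm.sign (pairPerm τ) = 1 := by
  rw [pairPerm, Equiv.Perm.sign_permCongr, Equiv.Perm.sign_prodCongrLeft]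
  simp

lemma polWedge_perm {n : ℕ} (τ : Equiv.Perm (Fin n))
    (M : Fin n → Matrix (Fin (2 * n)) (Fin (2 * n)) ℝ) :
    polWedge n (fun i => M (τ i)) = polWedge n M := by
  unfold polWedge
  rw [← Equiv.sum_comp (Equiv.mulRight (pairPerm τ))]
  refine Finset.sum_congr rfl fun σ _ => ?_
  simp only [Equiv.coe_mulRight, Equiv.Perm.sign_mul, sign_pairPerm, mul_one,
    Equiv.Perm.mul_apply, pairPerm_fst, pairPerm_snd]
  congr 1
  exact Equiv.prod_comp τ (fun i => M i (σ (pairFst i)) (σ (pairSnd i)))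

lemma exists_pair {n : ℕ} (k : Fin (2 * n)) : ∃ j : Fin n, k = pairFst j ∨ k = pairSnd j := by
  refine ⟨⟨k.1 / 2, by omega⟩, ?_⟩
  simp only [Fin.ext_iff, pairFst, pairSnd]
  omega

lemma pairFst_inj {n : ℕ} {i j : Fin n} : pairFst i = pairFst j ↔ i = j := by
  simp only [Fin.ext_iff, pairFst]; omega

lemma pairSnd_inj {n : ℕ} {i j : Fin n} : pairSnd i = pairSnd j ↔ i = j := by
  simp only [Fin.ext_iff, pairSnd]; omega

lemma pairFst_ne {n : ℕ} {i j : Fin n} : pairFst i ≠ pairSnd j := by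
  simp only [ne_eq, Fin.ext_iff, pairFst, pairSnd]; omega

/-- The multilinear map `x ↦ ∏ Mᵢ(x_{2i}, x_{2i+1})`. -/
def pairMul (n : ℕ) (M : Fin n → Matrix (Fin (2 * n)) (Fin (2 * n)) ℝ) :
    MultilinearMap ℝ (fun _ : Fin (2 * n) => (Fin (2 * n) → ℝ)) ℝ where
  toFun x := ∏ i, Matrix.toLinearMap₂' ℝ (M i) (x (pairFst i)) (x (pairSnd i))
  map_update_add' := by
    intro _ m k x y
    obtain ⟨j, hj⟩ := exists_pair k
    symm
    refine Finset.prod_add_prod_eq (Finset.mem_univ j) ?_ ?_ ?_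
    · rcases hj with rfl | rfl
      · simp [pairFst_ne.symm]
      · simp [pairFst_ne]
    all_goals
      intro i _ hi
      rcases hj with rfl | rfl
      · simp [pairFst_ne.symm, Function.update_of_ne (mt pairFst_inj.1 hi)]
      · simp [pairFst_ne, Function.update_of_ne (mt pairSnd_inj.1 hi)]
  map_update_smul' := by
    intro _ m k c x
    obtain ⟨j, hj⟩ := exists_pair k
    rw [smul_eq_mul, ← Finset.mul_prod_erase _ _ (Finset.mem_univ j),
      ← Finset.mul_prod_erase _ _ (Finset.mem_univ j), ← mul_assoc]
    congr 1
    · rcases hj with rfl | rfl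
      · simp [pairFst_ne.symm]
      · simp [pairFst_ne]
    · refine Finset.prod_congr rfl fun i hi => ?_
      have hi := Finset.ne_of_mem_erase hi
      rcases hj with rfl | rfl
      · simp [pairFst_ne.symm, Function.update_of_ne (mt pairFst_inj.1 hi)]
      · simp [pairFst_ne, Function.update_of_ne (mt pairSnd_inj.1 hi)]

lemma pairMul_apply {n : ℕ} (M : Fin n → Matrix (Fin (2 * n)) (Fin (2 * n)) ℝ)
    (x : Fin (2 * n) → Fin (2 * n) → ℝ) : pairMul n M x =
      ∏ i, Matrix.toLinearMap₂' ℝ (M i) (x (pairFst i)) (x (pairSnd i)) := rfl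

lemma polWedge_eq {n : ℕ} (M : Fin n → Matrix (Fin (2 * n)) (Fin (2 * n)) ℝ) :
    polWedge n M = MultilinearMap.alternatization (pairMul n M) (fun k => Pi.single k 1) := by
  rw [MultilinearMap.alternatization_apply]
  refine Finset.sum_congr rfl fun σ _ => ?_
  rw [MultilinearMap.domDomCongr_apply, pairMul_apply]
  simp [Matrix.toLinearMap₂'_apply', Units.smul_def]

lemma polWedge_zero {n : ℕ} (A : Matrix (Fin (2 * n)) (Fin (2 * n)) ℝ)
    (hanti : ∀ i j, A i j = -(A j i))
    (hker : Module.finrank ℝ (LinearMap.ker (Matrix.toLin' A)) = 4)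
    (M : Fin n → Matrix (Fin (2 * n)) (Fin (2 * n)) ℝ) (i0 : Fin n)
    (hM : ∀ i, i ≠ i0 → M i = A) : polWedge n M = 0 := by
  have hR : ∀ x y : Fin (2 * n) → ℝ, y ∈ LinearMap.ker (Matrix.toLin' A) → Matrix.toLinearMap₂' ℝ A x y = 0 := by
    intro x y hy
    rw [LinearMap.mem_ker, Matrix.toLin'_apply] at hy
    rw [Matrix.toLinearMap₂'_apply', hy, dotProduct_zero]
  have hL : ∀ x y : Fin (2 * n) → ℝ, x ∈ LinearMap.ker (Matrix.toLin' A) → Matrix.toLinearMap₂' ℝ A x y = 0 := by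
    intro x y hx
    rw [LinearMap.mem_ker, Matrix.toLin'_apply] at hx
    have hT : Aᵀ = -A := by
      ext i j; simp [hanti j i]
    rw [Matrix.toLinearMap₂'_apply', dotProduct_mulVec, ← mulVec_transpose, hT, neg_mulVec, hx]
    simp
  obtain ⟨Q, hQ⟩ := Submodule.exists_isCompl (LinearMap.ker (Matrix.toLin' A))
  set K := LinearMap.ker (Matrix.toLin' A) with hK
  let b := ((Module.finBasisOfFinrankEq ℝ K hker).prod (Module.finBasis ℝ Q)).map
    (Submodule.prodEquivOfIsCompl K Q hQ)
  have hb : ∀ k : Fin 4, b (Sum.inl k) ∈ K := by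
    intro k
    simp [b]
  rw [polWedge_eq]
  have h0 : MultilinearMap.alternatization (pairMul n M) = 0 := by
    refine Module.Basis.ext_alternating b fun w hw => ?_
    rw [MultilinearMap.alternatization_apply, AlternatingMap.zero_apply]
    refine Finset.sum_eq_zero fun σ _ => ?_
    rw [MultilinearMap.domDomCongr_apply, pairMul_apply]
    have hbij : Function.Bijective (fun k => w (σ k)) := by
      rw [Fintype.bijective_iff_injective_and_card]
      refine ⟨hw.comp σ.injective, ?_⟩
      rw [← Module.finrank_eq_card_basis b]
      simp
    choose c hc using fun k : Fin 4 => hbij.2 (Sum.inl k)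
    have hcinj : ∀ k l, c k = c l → k = l := by
      intro k l h
      have := (hc k).symm.trans ((congrArg (fun k => w (σ k)) h).trans (hc l))
      exact Sum.inl_injective this
    have hz : (∏ i, Matrix.toLinearMap₂' ℝ (M i) (b (w (σ (pairFst i))))
        (b (w (σ (pairSnd i))))) = 0 := by
      by_contra hne
      replace hne := Finset.prod_ne_zero_iff.1 hne
      have key : ∀ k, (c k).1 / 2 = i0.1 := by
        intro k
        by_contra hk
        obtain ⟨j, hj⟩ := exists_pair (c k)
        have hji : j ≠ i0 := by
          rintro rfl
          apply hk
          rcases hj with h | h <;> rw [h] <;> simp only [pairFst, pairSnd] <;> omega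
        apply hne j (Finset.mem_univ j)
        rw [hM j hji]
        have hck : b (w (σ (c k))) ∈ K := by
          have := hc k
          simp only at this
          rw [this]; exact hb k
        rcases hj with h | h
        · rw [h] at hck; exact hL _ _ hck
        · rw [h] at hck; exact hR _ _ hck
      have h01 : (c 0).1 ≠ (c 1).1 := fun h => by simpa using hcinj _ _ (Fin.ext h)
      have h02 : (c 0).1 ≠ (c 2).1 := fun h => by simpa using hcinj _ _ (Fin.ext h)
      have h12 : (c 1).1 ≠ (c 2).1 := fun h => by simpa using hcinj _ _ (Fin.ext h)
      have k0 := key 0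
      have k1 := key 1
      have k2 := key 2
      omega
    rw [hz, smul_zero]
  rw [h0]; rfl

/-- `polWedge` with `B` at the slots in `S` and `A` elsewhere. -/
def setWedge (n : ℕ) (A B : Matrix (Fin (2 * n)) (Fin (2 * n)) ℝ) (S : Finset (Fin n)) : ℝ :=
  polWedge n (fun i => if i ∈ S then B else A)

lemma wedgePow_add {n : ℕ} (A B : Matrix (Fin (2 * n)) (Fin (2 * n)) ℝ) (t : ℝ) :
    wedgePow n (A + t • B) = ∑ S : Finset (Fin n), t ^ S.card * setWedge n A B S := by
  unfold wedgePow setWedge polWedge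
  simp_rw [Finset.mul_sum]
  rw [Finset.sum_comm]
  refine Finset.sum_congr rfl fun σ _ => ?_
  have : ∀ i : Fin n, (A + t • B) (σ ⟨2 * i.1, by omega⟩) (σ ⟨2 * i.1 + 1, by omega⟩) =
      t * B (σ (pairFst i)) (σ (pairSnd i)) + A (σ (pairFst i)) (σ (pairSnd i)) := by
    intro i
    simp only [Matrix.add_apply, Matrix.smul_apply, smul_eq_mul, pairFst, pairSnd]
    ring
  simp_rw [this]
  rw [Finset.prod_add, Finset.powerset_univ, Finset.mul_sum]
  refine Finset.sum_congr rfl fun S _ => ?_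
  rw [Finset.prod_mul_distrib, Finset.prod_const, ← Finset.prod_mul_prod_compl S
    (fun i => (if i ∈ S then B else A) (σ (pairFst i)) (σ (pairSnd i))),
    ← Finset.compl_eq_univ_sdiff]
  rw [Finset.prod_congr rfl (g := fun i => B (σ (pairFst i)) (σ (pairSnd i)))
    (f := fun i => (if i ∈ S then B else A) (σ (pairFst i)) (σ (pairSnd i))) (s₁ := S)
    (fun i hi => by simp only [if_pos hi])]
  rw [Finset.prod_congr rfl (g := fun i => A (σ (pairFst i)) (σ (pairSnd i)))
    (f := fun i => (if i ∈ S then B else A) (σ (pairFst i)) (σ (pairSnd i))) (s₁ := Sᶜ)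
    (fun i hi => by simp only [if_neg (Finset.mem_compl.1 hi)])]
  ring

lemma setWedge_congr {n : ℕ} (A B : Matrix (Fin (2 * n)) (Fin (2 * n)) ℝ)
    (S T : Finset (Fin n)) (h : S.card = T.card) : setWedge n A B S = setWedge n A B T := by
  let e : {x // x ∈ S} ≃ {x // x ∈ T} := Finset.equivOfCardEq h
  have he : ∀ i, e.extendSubtype i ∈ T ↔ i ∈ S := fun i =>
    ⟨fun hi => by
      by_contra hS
      exact e.extendSubtype_not_mem i hS hi, fun hi => e.extendSubtype_mem i hi⟩
  unfold setWedge
  rw [← polWedge_perm e.extendSubtype (fun i => if i ∈ T then B else A)]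
  simp only [he]

lemma mixedPow_eq {n : ℕ} (hn : 2 ≤ n) (A B : Matrix (Fin (2 * n)) (Fin (2 * n)) ℝ) :
    ∃ T : Finset (Fin n), T.card = 2 ∧ mixedPow n hn A B = setWedge n A B T := by
  obtain ⟨m, rfl⟩ : ∃ m, n = m + 2 := ⟨n - 2, by omega⟩
  refine ⟨{(Fin.last m).castSucc, Fin.last (m + 1)}, ?_, ?_⟩
  · rw [Finset.card_pair]
    simp [Fin.ext_iff]
  · unfold mixedPow setWedge polWedge
    refine Finset.sum_congr rfl fun σ _ => ?_
    rw [Fin.prod_univ_castSucc, Fin.prod_univ_castSucc, mul_assoc, mul_assoc, mul_assoc]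
    congr 1
    congr 1
    · refine Finset.prod_congr rfl fun i _ => ?_
      beta_reduce
      rw [if_neg]
      · rfl
      · have := i.2
        simp only [Finset.mem_insert, Finset.mem_singleton, Fin.ext_iff, Fin.val_castSucc,
          Fin.val_last]
        simp only [Nat.add_sub_cancel] at this
        omega
    · congr 1
      · beta_reduce
        rw [if_pos (by simp)]
        congr 2
      · beta_reduce
        rw [if_pos (by simp)]
        congr 2

/-- let `ω` be a smooth closed 2-form on an open `U ⊆ ℝ^{2n}` with
`ω^n ≥ 0` pointwise, and `p ∈ U` a point where the kernel `K = ker(ω_p)` is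
4-dimensional. Then for every `v ∈ K`, `ω_p^{n-2} ∧ ((∇_p ω)(v))² ≥ 0`: the image of the
restricted intrinsic gradient `D_K` is semi-definite for the wedge-square form. -/
theorem gradient_image_semidefinite
    (n : ℕ) (hn : 2 ≤ n)
    (U : Set (Fin (2 * n) → ℝ)) (hU : IsOpen U)
    (ω : (Fin (2 * n) → ℝ) → Matrix (Fin (2 * n)) (Fin (2 * n)) ℝ)
    (hanti : ∀ q i j, ω q i j = -(ω q j i))
    (hsmooth : ∀ i j, ContDiffOn ℝ (⊤ : ℕ∞) (fun q => ω q i j) U)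
    (hclosed : ∀ q ∈ U, ∀ i j k : Fin (2 * n),
      fderiv ℝ (fun r => ω r j k) q (Pi.single i 1)
        + fderiv ℝ (fun r => ω r k i) q (Pi.single j 1)
        + fderiv ℝ (fun r => ω r i j) q (Pi.single k 1) = 0)
    (hpos : ∀ q ∈ U, 0 ≤ wedgePow n (ω q))
    (p : Fin (2 * n) → ℝ) (hp : p ∈ U)
    (hker : Module.finrank ℝ (LinearMap.ker (Matrix.toLin' (ω p))) = 4) :
    ∀ v ∈ LinearMap.ker (Matrix.toLin' (ω p)),
      0 ≤ mixedPow n hn (ω p)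
            (Matrix.of fun i j => fderiv ℝ (fun q => ω q i j) p v) := by
  intro v hv
  set A := ω p with hA
  set B : Matrix (Fin (2 * n)) (Fin (2 * n)) ℝ :=
    Matrix.of fun i j => fderiv ℝ (fun q => ω q i j) p v with hB
  let E : ℝ → Matrix (Fin (2 * n)) (Fin (2 * n)) ℝ := fun t => t⁻¹ • (ω (p + t • v) - A)
  have hE : ∀ i j, Tendsto (fun t => E t i j) (𝓝[>] 0) (𝓝 (B i j)) := by
    intro i j
    have hd : DifferentiableAt ℝ (fun q => ω q i j) p :=
      ((hsmooth i j).contDiffAt (hU.mem_nhds hp)).differentiableAt (by simp)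
    have h1 := (hd.hasFDerivAt.hasLineDerivAt v).tendsto_slope_zero_right
    simpa [E, hA, hB] using h1
  have hline : Tendsto (fun t : ℝ => p + t • v) (𝓝[>] 0) (𝓝 p) := by
    have : Continuous (fun t : ℝ => p + t • v) := by fun_prop
    have := (this.tendsto 0).mono_left (nhdsWithin_le_nhds (s := Set.Ioi 0))
    simpa using this
  have hsmall : ∀ S : Finset (Fin n), S.card < 2 → ∀ C, setWedge n A C S = 0 := by
    intro S hS C
    have : Nonempty (Fin n) := ⟨⟨0, by omega⟩⟩
    obtain ⟨i0, hi0⟩ := Finset.card_le_one_iff_subset_singleton.1 (Nat.lt_succ_iff.1 hS)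
    refine polWedge_zero A (hanti p) hker _ i0 fun i hi => ?_
    rw [if_neg]
    intro h
    exact hi (Finset.mem_singleton.1 (hi0 h))
  have hlim : Tendsto (fun t => ∑ S : Finset (Fin n),
      (if S.card < 2 then 0 else t ^ (S.card - 2) * setWedge n A (E t) S)) (𝓝[>] 0)
      (𝓝 (∑ S : Finset (Fin n),
        (if S.card < 2 then 0 else (0 : ℝ) ^ (S.card - 2) * setWedge n A B S))) := by
    refine tendsto_finsetSum _ fun S _ => ?_
    split_ifs with h
    · exact tendsto_const_nhds
    · refine Tendsto.mul ?_ ?_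
      · exact ((continuous_pow _).tendsto 0).mono_left nhdsWithin_le_nhds
      · unfold setWedge polWedge
        refine tendsto_finsetSum _ fun σ _ => Tendsto.mul tendsto_const_nhds ?_
        refine tendsto_finsetProd _ fun i _ => ?_
        beta_reduce
        split_ifs
        · exact hE _ _
        · exact tendsto_const_nhds
  have hnonneg := ge_of_tendsto hlim (b := 0) (by
    filter_upwards [hline (hU.mem_nhds hp), self_mem_nhdsWithin] with t ht ht0
    have ht0 : 0 < t := ht0
    have h1 := hpos _ ht
    have h2 : ω (p + t • v) = A + t • E t := by
      simp only [E]
      rw [smul_inv_smul₀ ht0.ne']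
      abel
    rw [h2, wedgePow_add] at h1
    have h3 : (∑ S : Finset (Fin n), t ^ S.card * setWedge n A (E t) S) =
        t ^ 2 * ∑ S : Finset (Fin n),
          (if S.card < 2 then 0 else t ^ (S.card - 2) * setWedge n A (E t) S) := by
      rw [Finset.mul_sum]
      refine Finset.sum_congr rfl fun S _ => ?_
      split_ifs with h
      · rw [hsmall S h, mul_zero, mul_zero]
      · rw [← mul_assoc, ← pow_add]
        congr 2
        omega
    rw [h3] at h1
    exact nonneg_of_mul_nonneg_right h1 (by positivity))
  obtain ⟨T, hT, hmix⟩ := mixedPow_eq hn A B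
  rw [hmix]
  have hsum : (∑ S : Finset (Fin n),
        (if S.card < 2 then 0 else (0 : ℝ) ^ (S.card - 2) * setWedge n A B S)) =
      ∑ S : Finset (Fin n), if S.card = 2 then setWedge n A B T else 0 := by
    refine Finset.sum_congr rfl fun S _ => ?_
    rcases lt_trichotomy S.card 2 with h | h | h
    · rw [if_pos h, if_neg h.ne]
    · rw [if_neg (by omega), if_pos h, h, setWedge_congr A B S T (h.trans hT.symm)]
      simp
    · rw [if_neg (by omega), if_neg h.ne', zero_pow (by omega), zero_mul]
  rw [hsum, ← Finset.sum_filter, Finset.sum_const, nsmul_eq_mul] at hnonneg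
  refine nonneg_of_mul_nonneg_right hnonneg ?_
  have : 0 < (Finset.univ.filter fun S : Finset (Fin n) => S.card = 2).card :=
    Finset.card_pos.2 ⟨T, by simp [hT]⟩
  exact_mod_cast this
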